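/- Let G = (V,E) be a finite simple graph with T triangles and arboricity at most α, and let τ > 0. Then the number of τ-light triangles of G is at least (1 − 3α/τ)·T. -/

import Mathlib

open Finset SimpleGraph
open scoped Classical

/-- The number of triangles (3-cliques) of `G` that contain the pair `e`. -/
noncomputable def triCount {V : Type*} [Fintype V] [DecidableEq V]
    (G : SimpleGraph V) [DecidableRel G.Adj] (e : Sym2 V) : ℕ :=
  ((G.cliqueFinset 3).filter (fun t => ∀ v ∈ e, v ∈ t)).card

/-- `G` has arboricity at most `a`: its edge set can be partitioned into `a` forests. -/
def ArboricityLE {V : Type*} (G : SimpleGraph V) (a : ℕ) : Prop :=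
  ∃ F : Fin a → SimpleGraph V,
    (∀ i, F i ≤ G) ∧ (∀ i, (F i).IsAcyclic) ∧
      ∀ e ∈ G.edgeSet, ∃! i, e ∈ (F i).edgeSet

/-- The arboricity of `G`: the minimum number of forests into which the edge set of `G`
can be partitioned. -/
noncomputable def arboricity {V : Type*} (G : SimpleGraph V) : ℕ :=
  sInf {a | ArboricityLE G a}

/-- A triangle `t` of `G` is τ-heavy if all three of its edges are τ-heavy
(i.e. each edge of `t` lies in more than `τ` triangles). -/
noncomputable def IsHeavyTriangle {V : Type*} [Fintype V] [DecidableEq V]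
    (G : SimpleGraph V) [DecidableRel G.Adj] (τ : ℝ) (t : Finset V) : Prop :=
  ∀ u ∈ t, ∀ v ∈ t, u ≠ v → τ < (triCount G s(u, v) : ℝ)


/-- The graph with a single edge `e` (or none if `e` is a loop) is acyclic. -/
lemma isAcyclic_fromEdgeSet_singleton {V : Type*} (e : Sym2 V) :
    (fromEdgeSet {e}).IsAcyclic := by
  induction e with | h u v =>
  by_cases huv : u = v
  · subst huv
    have h : fromEdgeSet {s(u, u)} = (⊥ : SimpleGraph V) := by
      ext x y
      simp only [fromEdgeSet_adj, Set.mem_singleton_iff, Sym2.eq_iff, bot_adj]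
      grind
    rw [h]
    exact isAcyclic_bot
  · have h := (isAcyclic_bot (V := V)).sup_edge_of_not_reachable (u := u) (v := v)
      (by simpa [reachable_bot] using huv)
    simpa [edge] using h

lemma exists_arboricityLE {V : Type*} [Fintype V] (G : SimpleGraph V) :
    ∃ a, ArboricityLE G a := by
  let φ := Fintype.equivFin G.edgeSet
  refine ⟨_, fun i => fromEdgeSet {(φ.symm i : Sym2 V)}, fun i => ?_,
    fun i => isAcyclic_fromEdgeSet_singleton _, fun e he => ⟨φ ⟨e, he⟩, ?_, fun j hj => ?_⟩⟩
  · intro x y hxy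
    have h : s(x, y) = (φ.symm i : Sym2 V) := by simpa using hxy.1
    rw [← mem_edgeSet, h]
    exact (φ.symm i).2
  · simpa using G.not_isDiag_of_mem_edgeSet he
  · have h : e = (φ.symm j : Sym2 V) := by
      simp only [edgeSet_fromEdgeSet] at hj
      exact hj.1
    rw [← Equiv.symm_apply_eq]
    exact Subtype.ext h.symm

lemma arboricityLE_arboricity {V : Type*} [Fintype V] (G : SimpleGraph V) :
    ArboricityLE G (arboricity G) :=
  Nat.sInf_mem (exists_arboricityLE G)

/-- A forest can be oriented with out-degree at most one: `p` sends a vertex to its parent. -/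
lemma SimpleGraph.IsAcyclic.exists_parent {V : Type*} {F : SimpleGraph V} (hF : F.IsAcyclic) :
    ∃ p : V → V, ∀ u v, F.Adj u v → p u = v ∨ p v = u := by
  have key : ∀ u : V, ∃ w : F.Walk u (F.connectedComponentMk u).out, w.IsPath := fun u =>
    (ConnectedComponent.exact (F.connectedComponentMk u).out_eq).symm.exists_isPath
  choose w hw using key
  refine ⟨fun u => (w u).snd, fun u v huv => ?_⟩
  by_cases hv : v ∈ (w u).support
  · exact Or.inl (hF.eq_snd_of_adj_start (hw u) huv hv).symm
  · right
    have hc : F.connectedComponentMk u = F.connectedComponentMk v :=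
      ConnectedComponent.sound huv.reachable
    have main : ∀ r, (∃ q : F.Walk u r, q.IsPath ∧ v ∉ q.support) →
        ∀ q' : F.Walk v r, q'.IsPath → q'.snd = u := by
      rintro r ⟨q, hq, hvq⟩ q' hq'
      have h := congrArg Subtype.val
        ((hF.subsingleton_path _ _).elim ⟨q', hq'⟩ ⟨Walk.cons huv.symm q, hq.cons hvq⟩)
      simp only at h
      rw [h, Walk.snd_cons]
    exact main _ (hc ▸ ⟨w u, hw u, hv⟩) (w v) (hw v)

/-- The sum of the numbers of triangles through the edges of a set `H` is at most `3T`. -/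
lemma sum_triCount_le {V : Type*} [Fintype V] [DecidableEq V]
    (G : SimpleGraph V) [DecidableRel G.Adj] (H : Finset (Sym2 V)) (hH : ∀ e ∈ H, ¬ e.IsDiag) :
    ∑ e ∈ H, triCount G e ≤ 3 * #(G.cliqueFinset 3) := by
  have h := sum_card_bipartiteAbove_eq_sum_card_bipartiteBelow (s := H) (t := G.cliqueFinset 3)
    (fun (e : Sym2 V) (t : Finset V) => ∀ v ∈ e, v ∈ t)
  have hl : ∑ e ∈ H, triCount G e = ∑ e ∈ H,
      #((G.cliqueFinset 3).bipartiteAbove (fun (e : Sym2 V) (t : Finset V) => ∀ v ∈ e, v ∈ t) e) := by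
    refine sum_congr rfl fun e _ => ?_
    simp only [triCount, bipartiteAbove]
  rw [hl, h, mul_comm, ← smul_eq_mul]
  refine sum_le_card_nsmul _ _ _ fun t ht => ?_
  have ht3 : #t = 3 := (mem_cliqueFinset_iff.1 ht).card_eq
  have hc : #(t.offDiag.image (Function.uncurry Sym2.mk)) = 3 := by
    rw [Sym2.card_image_offDiag, ht3]; rfl
  rw [← hc]
  refine card_le_card fun e he => ?_
  rw [mem_bipartiteBelow] at he
  obtain ⟨heH, het⟩ := he
  have hd := hH e heH
  induction e with | h u v =>
  exact mem_image.2 ⟨(u, v), mem_offDiag.2 ⟨het u (by simp), het v (by simp), by simpa using hd⟩, rfl⟩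

/-- A graph of arboricity at most `a` has at most `a * #H` triangles all of whose edges lie
in the set `H`. -/
lemma ArboricityLE.card_triangles_le {V : Type*} [Fintype V] [DecidableEq V]
    {G : SimpleGraph V} [DecidableRel G.Adj] {a : ℕ} (ha : ArboricityLE G a) (H : Finset (Sym2 V)) :
    #{t ∈ G.cliqueFinset 3 | ∀ u ∈ t, ∀ v ∈ t, u ≠ v → s(u, v) ∈ H} ≤ #H * a := by
  obtain ⟨F, -, hac, hF⟩ := ha
  choose p hp using fun i => (hac i).exists_parent
  have hout : ∀ u v, G.Adj u v → (∃ i, p i u = v) ∨ ∃ i, p i v = u := by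
    intro u v huv
    obtain ⟨i, hi, -⟩ := hF s(u, v) huv
    exact (hp i u v hi).imp (fun h => ⟨i, h⟩) fun h => ⟨i, h⟩
  have hhead : ∀ e : Sym2 V, ∃ y, e ∈ G.edgeSet → ∃ x, e = s(x, y) ∧ ∃ i, p i x = y := by
    intro e
    induction e with | h u v =>
    by_cases huv : G.Adj u v
    · rcases hout u v huv with h | h
      · exact ⟨v, fun _ => ⟨u, rfl, h⟩⟩
      · exact ⟨u, fun _ => ⟨v, Sym2.eq_swap, h⟩⟩
    · exact ⟨u, fun h => absurd h huv⟩
  choose head hhead using hhead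
  have hsplit : ∀ u v, G.Adj u v →
      (head s(u, v) = v ∧ ∃ i, p i u = v) ∨ (head s(u, v) = u ∧ ∃ i, p i v = u) := by
    intro u v huv
    obtain ⟨x, hx, hi⟩ := hhead s(u, v) huv
    rw [Sym2.eq_iff] at hx
    rcases hx with ⟨h1, h2⟩ | ⟨h1, h2⟩
    · left; rw [← h2, ← h1] at hi; exact ⟨h2.symm, hi⟩
    · right; rw [← h2, ← h1] at hi; exact ⟨h1.symm, hi⟩
  let f : Sym2 V × Fin a → Finset V := fun x => insert (p x.2 (head x.1)) x.1.toFinset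
  have hf : ∀ x y z, s(x, y) ∈ H → head s(x, y) = y → (∃ i, p i y = z) →
      ({x, y, z} : Finset V) ∈ (H ×ˢ (univ : Finset (Fin a))).image f := by
    rintro x y z hxy hy ⟨i, hi⟩
    refine mem_image.2 ⟨(s(x, y), i), by simpa using hxy, ?_⟩
    ext w
    simp only [f, hy, hi, mem_insert, Sym2.mem_toFinset, Sym2.mem_iff, mem_singleton]
    tauto
  calc _ ≤ #((H ×ˢ (univ : Finset (Fin a))).image f) := card_le_card fun t ht => ?_
    _ ≤ #(H ×ˢ (univ : Finset (Fin a))) := card_image_le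
    _ = #H * a := by simp
  rw [mem_filter, mem_cliqueFinset_iff, is3Clique_iff] at ht
  obtain ⟨⟨x, y, z, hxy, hxz, hyz, rfl⟩, hH⟩ := ht
  have hHxy := hH x (by simp) y (by simp) hxy.ne
  have hHxz := hH x (by simp) z (by simp) hxz.ne
  have hHyz := hH y (by simp) z (by simp) hyz.ne
  have e1 : ({x, y, z} : Finset V) = {y, x, z} := by grind
  have e2 : ({x, y, z} : Finset V) = {x, z, y} := by grind
  have e3 : ({x, y, z} : Finset V) = {z, x, y} := by grind
  have e4 : ({x, y, z} : Finset V) = {y, z, x} := by grind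
  have e5 : ({x, y, z} : Finset V) = {z, y, x} := by grind
  have swap : ∀ u v : V, s(u, v) = s(v, u) := fun _ _ => Sym2.eq_swap
  rcases hsplit x y hxy with ⟨h1, h1'⟩ | ⟨h1, h1'⟩ <;>
  rcases hsplit y z hyz with ⟨h2, h2'⟩ | ⟨h2, h2'⟩ <;>
  rcases hsplit x z hxz with ⟨h3, h3'⟩ | ⟨h3, h3'⟩ <;> grind

/-- In a finite simple graph with `T` triangles and arboricity at most `α`,
for any `τ > 0`, the number of τ-light triangles is at least `(1 − 3α/τ)·T`. -/
theorem light_triangles_card_ge {V : Type*} [Fintype V] [DecidableEq V]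
    (G : SimpleGraph V) [DecidableRel G.Adj] (α : ℕ) (hα : arboricity G ≤ α)
    (τ : ℝ) (hτ : 0 < τ) :
    (1 - 3 * (α : ℝ) / τ) * ((G.cliqueFinset 3).card : ℝ) ≤
      (((G.cliqueFinset 3).filter (fun t => ¬ IsHeavyTriangle G τ t)).card : ℝ) := by
  set H : Finset (Sym2 V) := {e ∈ G.edgeFinset | τ < (triCount G e : ℝ)} with hHdef
  have hcard : (#H : ℝ) * τ ≤ 3 * #(G.cliqueFinset 3) := by
    have h1 : ∑ e ∈ H, triCount G e ≤ 3 * #(G.cliqueFinset 3) :=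
      sum_triCount_le G H fun e he =>
        G.not_isDiag_of_mem_edgeSet (mem_edgeFinset.1 (mem_filter.1 he).1)
    have h2 : #H • τ ≤ ∑ e ∈ H, (triCount G e : ℝ) :=
      card_nsmul_le_sum _ _ _ fun e he => (mem_filter.1 he).2.le
    rw [nsmul_eq_mul] at h2
    exact h2.trans (by exact_mod_cast h1)
  have hheavy : #{t ∈ G.cliqueFinset 3 | IsHeavyTriangle G τ t} ≤ #H * α := by
    refine le_trans (card_le_card fun t ht => ?_)
      (((arboricityLE_arboricity G).card_triangles_le H).trans (Nat.mul_le_mul_left _ hα))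
    rw [mem_filter] at ht ⊢
    refine ⟨ht.1, fun u hu v hv huv => mem_filter.2 ⟨mem_edgeFinset.2 ?_, ht.2 u hu v hv huv⟩⟩
    exact (mem_cliqueFinset_iff.1 ht.1).isClique hu hv huv
  have hsum := card_filter_add_card_filter_not (s := G.cliqueFinset 3) (IsHeavyTriangle G τ)
  have hsum' : (#{t ∈ G.cliqueFinset 3 | IsHeavyTriangle G τ t} : ℝ) +
      #{t ∈ G.cliqueFinset 3 | ¬ IsHeavyTriangle G τ t} = #(G.cliqueFinset 3) := by
    exact_mod_cast hsum
  have hheavy' : (#{t ∈ G.cliqueFinset 3 | IsHeavyTriangle G τ t} : ℝ) ≤ #H * α := by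
    exact_mod_cast hheavy
  have hbound : (#H : ℝ) * α ≤ 3 * (α : ℝ) / τ * #(G.cliqueFinset 3) := by
    rw [div_mul_eq_mul_div, le_div_iff₀ hτ]
    calc (#H : ℝ) * α * τ = α * (#H * τ) := by ring
      _ ≤ α * (3 * #(G.cliqueFinset 3)) := by gcongr
      _ = 3 * α * #(G.cliqueFinset 3) := by ring
  linarith
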